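/- General (non-grey) exact dispersion relation: let T > 0, c_M > 0, and let σ_A, σ_S : (0,∞) → [0,∞) be measurable. Let k ∈ ℝ∖{0}, ω ∈ ℂ, δT ∈ ℂ∖{0}, and suppose that for a.e. q > 0 one has Re(σ_A(q) + σ_S(q) − iω) > 0 and 1 − σ_S(q)H(q) ≠ 0, where H(q) = arctan(k/(σ_A(q) + σ_S(q) − iω))/k (principal complex arctan). Suppose a measurable δf : ℝ³∖{0} → ℂ satisfies the plane-wave radiative transfer system (i)–(ii) with all stated integrals finite, and suppose the function q ↦ q⁴ f_BB(q)(1+f_BB(q)) σ_A(q)[1 − (σ_A(q)+σ_S(q))H(q)]/[1 − σ_S(q)H(q)] is integrable on (0,∞). Then ω = −i (c_R/c_M) · ⟨ σ_A (1 − (σ_A+σ_S)H)/(1 − σ_S H) ⟩, where c_R = 4π²T³/15 and ⟨X⟩ := ∫₀^∞ q⁴ f_BB(q)(1+f_BB(q)) X(q) dq / ∫₀^∞ q⁴ f_BB(q)(1+f_BB(q)) dq is the Rosseland-weighted average. -/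

import Mathlib

/-! Statement 7: the exact (non-grey) implicit dispersion relation of radiative
transfer: ω = −i(c_R/c_M)⟨σ_A(1−(σ_A+σ_S)H)/(1−σ_S H)⟩, with H(q) =
arctan(k/(σ_A(q)+σ_S(q)−iω))/k and ⟨·⟩ the Rosseland-weighted average. -/

noncomputable section
open MeasureTheory Real Set

/-- Physical momentum space `ℝ³`. -/
abbrev R3 : Type := EuclideanSpace ℝ (Fin 3)

/-- Black-body occupation number `f_BB(q) = 1/(e^{q/T} - 1)`. -/
def fBB (T q : ℝ) : ℝ := 1 / (Real.exp (q / T) - 1)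

/-- Entropy weight `w(q) = 2 / ((2π)³ f_BB(q)(1 + f_BB(q)))`. -/
def wgt (T q : ℝ) : ℝ := 2 / ((2 * Real.pi) ^ 3 * (fBB T q * (1 + fBB T q)))

/-- Perturbation of the black-body distribution,
`δf_BB(q) = f_BB(q)(1 + f_BB(q)) q δT / T²`. -/
def δfBB (T : ℝ) (δT : ℂ) (q : ℝ) : ℂ :=
  ((fBB T q * (1 + fBB T q) * q / T ^ 2 : ℝ) : ℂ) * δT

/-- Average of `δf` over the unit sphere of directions at energy `q`:
`δf̄(q) = (1/(4π)) ∫_{S²} δf(qΩ) dσ(Ω)`. -/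
def sphAvg (δf : R3 → ℂ) (q : ℝ) : ℂ :=
  (4 * Real.pi : ℝ)⁻¹ •
    ∫ Ω : Metric.sphere (0 : R3) 1, δf (q • (Ω : R3)) ∂((volume : Measure R3).toSphere)

/-- The collision term
`σ_A(|p|)(δf_BB(|p|) − δf(p)) + σ_S(|p|)(δf̄(|p|) − δf(p))`. -/
def coll (σA σS : ℝ → ℝ) (T : ℝ) (δT : ℂ) (δf : R3 → ℂ) (p : R3) : ℂ :=
  (σA ‖p‖ : ℝ) * (δfBB T δT ‖p‖ - δf p) + (σS ‖p‖ : ℝ) * (sphAvg δf ‖p‖ - δf p)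

/-- The angular factor `H(q) = arctan(k/(σ_A(q)+σ_S(q)−iω))/k`. -/
def Hfun (σA σS : ℝ → ℝ) (ω : ℂ) (k : ℝ) (q : ℝ) : ℂ :=
  Complex.arctan ((k : ℂ) / (((σA q + σS q : ℝ) : ℂ) - Complex.I * ω)) / (k : ℂ)

lemma integral_inv_add_mul_I {a : ℂ} (ha : 0 < a.re) {k : ℝ} (hk : k ≠ 0) :
    ∫ μ in (-1 : ℝ)..1, (a + Complex.I * k * μ)⁻¹ = 2 * (Complex.arctan (k / a) / k) := by
  have ha0 : a ≠ 0 := by rintro rfl; simp at ha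
  have hkC : (k : ℂ) ≠ 0 := by exact_mod_cast hk
  have hre (μ : ℝ) : 0 < (a + Complex.I * k * μ).re := by simpa using ha
  have hne (μ : ℝ) : a + Complex.I * k * μ ≠ 0 := fun h => by
    have := hre μ
    simp [h] at this
  have hderiv (μ : ℝ) : HasDerivAt
      (fun μ : ℝ => Complex.log (a + Complex.I * k * μ) / (Complex.I * k))
      (a + Complex.I * k * μ)⁻¹ μ := by
    have h1 : HasDerivAt (fun μ : ℝ => a + Complex.I * k * μ) (Complex.I * k) μ := by
      simpa using ((Complex.ofRealCLM.hasDerivAt (x := μ)).const_mul (Complex.I * k)).const_add a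
    convert! (h1.clog_real (Or.inl (hre μ))).div_const (Complex.I * k) using 1
    have := hne μ
    field_simp
  have hcont : Continuous fun μ : ℝ => (a + Complex.I * k * μ)⁻¹ :=
    Continuous.inv₀ (by fun_prop) hne
  rw [intervalIntegral.integral_eq_sub_of_hasDerivAt (fun μ _ => hderiv μ)
    (hcont.intervalIntegrable _ _), Complex.arctan]
  have hquot : (1 + k / a * Complex.I) / (1 - k / a * Complex.I)
      = (a + Complex.I * k * (1 : ℝ)) / (a + Complex.I * k * (-1 : ℝ)) := by
    rw [← mul_div_mul_left _ _ ha0]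
    congr 1 <;> push_cast <;> field_simp
    ring
  have h1 := Complex.abs_arg_lt_pi_div_two_iff.2 (Or.inl (hre 1))
  have h2 := Complex.abs_arg_lt_pi_div_two_iff.2 (Or.inl (hre (-1)))
  rw [abs_lt] at h1 h2
  have hlog : Complex.log ((a + Complex.I * k * (1 : ℝ)) / (a + Complex.I * k * (-1 : ℝ)))
      = Complex.log (a + Complex.I * k * (1 : ℝ)) - Complex.log (a + Complex.I * k * (-1 : ℝ)) := by
    have hinv : Complex.log (a + Complex.I * k * (-1 : ℝ))⁻¹
        = -Complex.log (a + Complex.I * k * (-1 : ℝ)) :=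
      Complex.log_inv _ (by linarith [h2.2, pi_pos])
    rw [div_eq_mul_inv, Complex.log_mul (hne 1) (inv_ne_zero (hne (-1))), hinv, sub_eq_add_neg]
    rw [Complex.arg_inv, if_neg (by linarith [h2.2, pi_pos])]
    constructor <;> linarith [h1.1, h1.2, h2.1, h2.2]
  rw [hquot, hlog]
  field_simp
  rw [Complex.I_sq]
  ring

lemma integral_pow_four_mul_exp_neg_mul {r : ℝ} (hr : 0 < r) :
    ∫ q in Ioi (0 : ℝ), q ^ 4 * exp (-(r * q)) = 24 / r ^ 5 := by
  have hG : Gamma 5 = 24 := by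
    have := Gamma_nat_eq_factorial 4
    rw [show ((4 : ℕ) : ℝ) + 1 = 5 by norm_num] at this
    norm_num [this, Nat.factorial]
  have h5 : (1 / r : ℝ) ^ (5 : ℝ) = (1 / r) ^ 5 := by exact_mod_cast rpow_natCast (1 / r) 5
  have h4 (t : ℝ) : t ^ ((5 : ℝ) - 1) = t ^ 4 := by
    rw [show (5 : ℝ) - 1 = (4 : ℕ) by norm_num, rpow_natCast]
  have h := integral_rpow_mul_exp_neg_mul_Ioi (a := 5) (by norm_num) hr
  simp only [h4, h5, hG] at h
  rw [h]
  field_simp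

lemma integral_pow_four_mul_fBB {T : ℝ} (hT : 0 < T) :
    ∫ q in Ioi (0 : ℝ), q ^ 4 * fBB T q * (1 + fBB T q) = 4 * π ^ 4 * T ^ 5 / 15 := by
  have hI (n : ℕ) : ∫ q in Ioi (0 : ℝ), (n + 1 : ℝ) * (q ^ 4 * exp (-((n + 1) / T * q)))
      = 24 * T ^ 5 * (1 / ((n + 1 : ℕ) : ℝ) ^ 4) := by
    have hn : (0 : ℝ) < n + 1 := by positivity
    rw [integral_const_mul, integral_pow_four_mul_exp_neg_mul (by positivity)]
    push_cast
    field_simp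
  have hint (n : ℕ) : Integrable (fun q : ℝ => (n + 1 : ℝ) * (q ^ 4 * exp (-((n + 1) / T * q))))
      (volume.restrict (Ioi 0)) := by
    refine not_imp_comm.1 integral_undef ?_
    rw [hI]
    positivity
  have hz : HasSum (fun n : ℕ => 24 * T ^ 5 * (1 / ((n + 1 : ℕ) : ℝ) ^ 4))
      (24 * T ^ 5 * (π ^ 4 / 90)) := by
    refine HasSum.mul_left _ ?_
    refine (hasSum_nat_add_iff (f := fun n : ℕ => 1 / (n : ℝ) ^ 4) 1).2 ?_
    simpa using hasSum_zeta_four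
  have hnorm (n : ℕ) :
      ∫ q in Ioi (0 : ℝ), ‖(n + 1 : ℝ) * (q ^ 4 * exp (-((n + 1) / T * q)))‖
      = 24 * T ^ 5 * (1 / ((n + 1 : ℕ) : ℝ) ^ 4) := by
    rw [← hI]
    refine integral_congr_ae (ae_of_all _ fun q => ?_)
    exact norm_of_nonneg (by positivity)
  have hs := hasSum_integral_of_summable_integral_norm hint (by simpa only [hnorm] using hz.summable)
  simp only [hI] at hs
  have := hz.unique hs
  rw [show 4 * π ^ 4 * T ^ 5 / 15 = 24 * T ^ 5 * (π ^ 4 / 90) by ring, this]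
  refine setIntegral_congr_fun measurableSet_Ioi fun q (hq : 0 < q) => ?_
  have hlt : exp (-(q / T)) < 1 := exp_lt_one_iff.2 (by simpa using div_pos hq hT)
  have hgt : 1 < exp (q / T) := one_lt_exp_iff.2 (div_pos hq hT)
  have hg := hasSum_coe_mul_geometric_of_norm_lt_one (r := exp (-(q / T)))
    (by rwa [norm_of_nonneg (exp_pos _).le])
  have hg' : HasSum (fun n : ℕ => (n + 1 : ℝ) * (q ^ 4 * exp (-((n + 1) / T * q))))
      (q ^ 4 * (exp (-(q / T)) / (1 - exp (-(q / T))) ^ 2)) := by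
    have h1 := ((hasSum_nat_add_iff' 1).2 hg).mul_left (q ^ 4)
    simp only [Finset.range_one, Finset.sum_singleton, Nat.cast_zero, zero_mul, sub_zero] at h1
    refine h1.congr_fun fun n => ?_
    rw [← exp_nat_mul]
    push_cast
    rw [show ((n : ℝ) + 1) * -(q / T) = -((n + 1) / T * q) by ring]
    ring
  rw [hg'.tsum_eq, fBB, exp_neg]
  have : exp (q / T) - 1 ≠ 0 := by linarith
  have h3 : exp (q / T) ≠ 0 := (exp_pos _).ne'
  field_simp
  ring

lemma measurePreserving_polar :
    MeasurePreserving (fun x : Metric.sphere (0 : R3) 1 × Ioi (0 : ℝ) => x.2.1 • (x.1 : R3))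
      ((volume : Measure R3).toSphere.prod (Measure.volumeIoiPow 2)) volume := by
  have h := (volume : Measure R3).measurePreserving_homeomorphUnitSphereProd
  have h' := h.symm (homeomorphUnitSphereProd R3).toMeasurableEquiv
  have hv : MeasurePreserving (Subtype.val : ({0}ᶜ : Set R3) → R3) (volume.comap Subtype.val)
      volume := by
    refine ⟨measurable_subtype_coe, ?_⟩
    rw [map_comap_subtype_coe (measurableSet_singleton _).compl, restrict_compl_singleton]
  have := hv.comp h'
  simpa [Function.comp_def] using this

lemma ae_volumeIoiPow_iff (n : ℕ) {P : ℝ → Prop} :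
    (∀ᵐ r : Ioi (0 : ℝ) ∂Measure.volumeIoiPow n, P r) ↔
      ∀ᵐ r ∂volume.restrict (Ioi (0 : ℝ)), P r := by
  rw [Measure.volumeIoiPow, ae_withDensity_iff (by fun_prop),
    ← map_comap_subtype_coe measurableSet_Ioi,
    (MeasurableEmbedding.subtype_coe measurableSet_Ioi).ae_map_iff]
  refine Filter.eventually_congr (ae_of_all _ fun r => ?_)
  have : ENNReal.ofReal ((r : ℝ) ^ n) ≠ 0 := by
    simpa using pow_pos r.2.out n
  simp [this]

lemma ae_ae_polar {P : R3 → Prop} (h : ∀ᵐ p, P p) :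
    ∀ᵐ r ∂volume.restrict (Ioi (0 : ℝ)),
      ∀ᵐ Ω : Metric.sphere (0 : R3) 1 ∂(volume : Measure R3).toSphere, P (r • (Ω : R3)) := by
  rw [← ae_volumeIoiPow_iff 2]
  have h1 := measurePreserving_polar.quasiMeasurePreserving.ae h
  have h2 := Measure.measurePreserving_swap (μ := Measure.volumeIoiPow 2)
    (ν := (volume : Measure R3).toSphere) |>.quasiMeasurePreserving.ae h1
  exact Measure.ae_ae_of_ae_prod h2

lemma integral_volumeIoiPow {E : Type*} [NormedAddCommGroup E] [NormedSpace ℝ E] (n : ℕ)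
    (f : ℝ → E) :
    ∫ r : Ioi (0 : ℝ), f r ∂Measure.volumeIoiPow n = ∫ r in Ioi (0 : ℝ), r ^ n • f r := by
  simp only [Measure.volumeIoiPow, ENNReal.ofReal]
  rw [integral_withDensity_eq_integral_smul,
    integral_subtype_comap measurableSet_Ioi fun a ↦ Real.toNNReal (a ^ n) • f a,
    setIntegral_congr_fun measurableSet_Ioi fun x hx ↦ ?_]
  · rw [NNReal.smul_def, Real.coe_toNNReal _ (pow_nonneg hx.out.le _)]
  · exact (measurable_subtype_coe.pow_const _).real_toNNReal

lemma integral_polar {E : Type*} [NormedAddCommGroup E] [NormedSpace ℝ E] {F : R3 → E}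
    (hF : Integrable F) :
    ∫ p, F p = ∫ r in Ioi (0 : ℝ), r ^ 2 •
      ∫ Ω : Metric.sphere (0 : R3) 1, F (r • (Ω : R3)) ∂(volume : Measure R3).toSphere := by
  have h := measurePreserving_polar
  rw [← integral_volumeIoiPow 2 fun r => ∫ Ω : Metric.sphere (0 : R3) 1, F (r • (Ω : R3))
    ∂(volume : Measure R3).toSphere]
  have h1 := integral_map (μ := (volume : Measure R3).toSphere.prod (Measure.volumeIoiPow 2))
    h.measurable.aemeasurable (f := F) (by rw [h.map_eq]; exact hF.1)
  rw [h.map_eq] at h1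
  exact h1.trans (integral_prod_symm _ (h.integrable_comp_of_integrable hF))

lemma integral_Ioi_pow_mul_exp_neg_sq (n : ℕ) :
    ∫ x in Ioi (0 : ℝ), x ^ n * exp (-x ^ 2) = Gamma ((n + 1) / 2) / 2 := by
  have h := integral_rpow_mul_exp_neg_rpow (p := 2) (q := n) (by norm_num)
    (by linarith [n.cast_nonneg (α := ℝ)])
  have h2 (t : ℝ) : t ^ (2 : ℝ) = t ^ 2 := by exact_mod_cast rpow_natCast t 2
  simp only [rpow_natCast, h2] at h
  rw [h]
  ring

lemma integrable_pow_mul_exp_neg_sq (n : ℕ) : Integrable fun x : ℝ => x ^ n * exp (-x ^ 2) := by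
  simpa using integrable_rpow_mul_exp_neg_mul_sq one_pos (s := n)
    (by linarith [n.cast_nonneg (α := ℝ)])

lemma integral_pow_mul_exp_neg_sq (n : ℕ) :
    ∫ x : ℝ, x ^ n * exp (-x ^ 2) = (1 + (-1) ^ n) * (Gamma ((n + 1) / 2) / 2) := by
  have hi := integrable_pow_mul_exp_neg_sq n
  rw [← intervalIntegral.integral_Iic_add_Ioi (b := 0) hi.integrableOn hi.integrableOn,
    integral_Ioi_pow_mul_exp_neg_sq]
  have h := integral_comp_neg_Ioi (0 : ℝ) fun x : ℝ => x ^ n * exp (-x ^ 2)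
  rw [neg_zero] at h
  rw [← h]
  have (x : ℝ) : (-x) ^ n * exp (-(-x) ^ 2) = (-1) ^ n * (x ^ n * exp (-x ^ 2)) := by
    rw [neg_pow x n, neg_sq, mul_assoc]
  simp only [this]
  rw [integral_const_mul, integral_Ioi_pow_mul_exp_neg_sq]
  ring

lemma exp_neg_norm_sq_eq_prod (n : ℕ) (v : Fin 3 → ℝ) :
    v 0 ^ n * exp (-‖(WithLp.toLp 2 v : R3)‖ ^ 2)
      = ∏ i : Fin 3, v i ^ (if i = 0 then n else 0) * exp (-v i ^ 2) := by
  rw [EuclideanSpace.norm_sq_eq]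
  simp only [Fin.prod_univ_three, Fin.sum_univ_three, norm_eq_abs, sq_abs]
  rw [neg_add, neg_add, exp_add, exp_add]
  simp
  ring

lemma integral_sphere_pow (n : ℕ) :
    ∫ Ω : Metric.sphere (0 : R3) 1, (Ω : R3) 0 ^ n ∂(volume : Measure R3).toSphere
      = 2 * π * ((1 + (-1) ^ n) / (n + 1)) := by
  have hmp := PiLp.volume_preserving_toLp (Fin 3)
  have hemb : MeasurableEmbedding (WithLp.toLp 2 : (Fin 3 → ℝ) → R3) :=
    (MeasurableEquiv.toLp 2 _).measurableEmbedding
  have hint : Integrable fun p : R3 => p 0 ^ n * exp (-‖p‖ ^ 2) := by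
    rw [← hmp.integrable_comp_emb hemb]
    simp only [Function.comp_def, exp_neg_norm_sq_eq_prod]
    exact Integrable.fintype_prod
      (f := fun i : Fin 3 => fun x : ℝ => x ^ (if i = 0 then n else 0) * exp (-x ^ 2))
      fun i => integrable_pow_mul_exp_neg_sq _
  have hfull : ∫ p : R3, p 0 ^ n * exp (-‖p‖ ^ 2)
      = π * ((1 + (-1) ^ n) * (Gamma ((n + 1) / 2) / 2)) := by
    rw [← hmp.integral_comp hemb]
    simp only [exp_neg_norm_sq_eq_prod]
    rw [integral_fintype_prod_volume_eq_prod
      (fun i : Fin 3 => fun x : ℝ => x ^ (if i = 0 then n else 0) * exp (-x ^ 2))]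
    simp only [Fin.prod_univ_three, integral_pow_mul_exp_neg_sq]
    norm_num [Gamma_one_half_eq, show (2 : Fin 3) ≠ 0 by decide]
    linear_combination
      (1 + (-1) ^ n) * (Gamma ((n + 1) / 2) / 2) * mul_self_sqrt pi_pos.le
  have hpol := integral_polar hint
  have hrad : ∀ r ∈ Ioi (0 : ℝ), r ^ 2 • ∫ Ω : Metric.sphere (0 : R3) 1,
      (r • (Ω : R3)) 0 ^ n * exp (-‖r • (Ω : R3)‖ ^ 2) ∂(volume : Measure R3).toSphere
      = (r ^ (n + 2) * exp (-r ^ 2)) *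
        ∫ Ω : Metric.sphere (0 : R3) 1, (Ω : R3) 0 ^ n ∂(volume : Measure R3).toSphere := by
    intro r hr
    rw [← integral_const_mul, smul_eq_mul, ← integral_const_mul]
    congr 1 with Ω
    have : ‖r • (Ω : R3)‖ = r := by simp [norm_smul, abs_of_pos hr.out]
    rw [this, PiLp.smul_apply, smul_eq_mul]
    ring
  rw [hfull, setIntegral_congr_fun measurableSet_Ioi hrad, integral_mul_const,
    integral_Ioi_pow_mul_exp_neg_sq] at hpol
  have hG : Gamma (((n + 2 : ℕ) + 1) / 2) = (n + 1) / 2 * Gamma ((n + 1) / 2) := by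
    rw [← Gamma_add_one (by positivity)]
    push_cast
    ring_nf
  rw [hG] at hpol
  have hpos : 0 < Gamma (((n : ℝ) + 1) / 2) := Gamma_pos_of_pos (by positivity)
  field_simp at hpol ⊢
  linarith

lemma map_sphere_eval_zero :
    (volume : Measure R3).toSphere.map (fun Ω : Metric.sphere (0 : R3) 1 => (Ω : R3) 0)
      = ENNReal.ofReal (2 * π) • volume.restrict (Icc (-1 : ℝ) 1) := by
  have hm : Measurable fun Ω : Metric.sphere (0 : R3) 1 => (Ω : R3) 0 := by fun_prop
  set ν : Measure ℝ := (volume : Measure R3).toSphere.map fun Ω : Metric.sphere (0 : R3) 1 => (Ω : R3) 0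
    with hν
  set ρ := ENNReal.ofReal (2 * π) • volume.restrict (Icc (-1 : ℝ) 1) with hρ
  have : IsFiniteMeasure ρ := Measure.smul_finite _ ENNReal.ofReal_ne_top
  have hνs : ∀ᵐ x ∂ν, x ∈ Icc (-1 : ℝ) 1 := by
    refine (ae_map_iff (p := fun x : ℝ => x ∈ Icc (-1 : ℝ) 1) hm.aemeasurable
      measurableSet_Icc).2 (ae_of_all _ fun Ω => ?_)
    have := PiLp.norm_apply_le (Ω : R3) 0
    rw [norm_eq_of_mem_sphere, norm_eq_abs] at this
    exact abs_le.1 this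
  have hρs : ∀ᵐ x ∂ρ, x ∈ Icc (-1 : ℝ) 1 :=
    Measure.ae_smul_measure (ae_restrict_mem measurableSet_Icc) _
  have hintν {g : ℝ → ℝ} (hg : Continuous g) : Integrable g ν := by
    obtain ⟨C, hC⟩ := (isCompact_Icc (a := (-1 : ℝ)) (b := 1)).exists_bound_of_continuousOn
      hg.continuousOn
    exact Integrable.of_bound hg.aestronglyMeasurable C (hνs.mono hC)
  have hintρ {g : ℝ → ℝ} (hg : Continuous g) : Integrable g ρ := by
    obtain ⟨C, hC⟩ := (isCompact_Icc (a := (-1 : ℝ)) (b := 1)).exists_bound_of_continuousOn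
      hg.continuousOn
    exact Integrable.of_bound hg.aestronglyMeasurable C (hρs.mono hC)
  have hmono (n : ℕ) : ∫ x, x ^ n ∂ν = ∫ x, x ^ n ∂ρ := by
    rw [hν, integral_map hm.aemeasurable (by fun_prop), integral_sphere_pow, hρ,
      integral_smul_measure, integral_Icc_eq_integral_Ioc,
      ← intervalIntegral.integral_of_le (by norm_num), integral_pow,
      ENNReal.toReal_ofReal (by positivity), smul_eq_mul, pow_succ]
    ring
  have hpoly (p : Polynomial ℝ) : ∫ x, p.eval x ∂ν = ∫ x, p.eval x ∂ρ := by
    simp only [Polynomial.eval_eq_sum_range]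
    rw [integral_finsetSum _ fun i _ => hintν (by fun_prop),
      integral_finsetSum _ fun i _ => hintρ (by fun_prop)]
    simp only [integral_const_mul, hmono]
  refine ext_of_forall_integral_eq_of_IsFiniteMeasure fun f => ?_
  have key (ε : ℝ) (hε : 0 < ε) :
      |∫ x, f x ∂ν - ∫ x, f x ∂ρ| ≤ ε * (ν.real univ + ρ.real univ) := by
    obtain ⟨p, hp⟩ := exists_polynomial_near_of_continuousOn (-1) 1 f f.continuous.continuousOn ε hε
    have h1 : ‖∫ x, (p.eval x - f x) ∂ν‖ ≤ ε * ν.real univ :=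
      norm_integral_le_of_norm_le_const (hνs.mono fun x hx => (hp x hx).le)
    have h2 : ‖∫ x, (p.eval x - f x) ∂ρ‖ ≤ ε * ρ.real univ :=
      norm_integral_le_of_norm_le_const (hρs.mono fun x hx => (hp x hx).le)
    rw [integral_sub (hintν p.continuous) (hintν f.continuous), norm_eq_abs, abs_le] at h1
    rw [integral_sub (hintρ p.continuous) (hintρ f.continuous), norm_eq_abs, abs_le] at h2
    rw [hpoly] at h1
    rw [abs_le]
    constructor <;> linarith [h1.1, h1.2, h2.1, h2.2]
  refine sub_eq_zero.1 (abs_eq_zero.1 (le_antisymm ?_ (abs_nonneg _)))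
  refine le_of_forall_pos_le_add fun δ hδ => ?_
  have hpos : 0 < ν.real univ + ρ.real univ + 1 := by positivity
  refine (key (δ / (ν.real univ + ρ.real univ + 1)) (by positivity)).trans ?_
  rw [zero_add, div_mul_eq_mul_div, div_le_iff₀ hpos]
  nlinarith

lemma integral_sphere_comp_eval_zero {g : ℝ → ℂ} (hg : Continuous g) :
    ∫ Ω : Metric.sphere (0 : R3) 1, g ((Ω : R3) 0) ∂(volume : Measure R3).toSphere
      = 2 * π * ∫ μ in (-1 : ℝ)..1, g μ := by
  have hm : Measurable fun Ω : Metric.sphere (0 : R3) 1 => (Ω : R3) 0 := by fun_prop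
  rw [← integral_map hm.aemeasurable hg.aestronglyMeasurable, map_sphere_eval_zero,
    integral_smul_measure, integral_Icc_eq_integral_Ioc,
    ← intervalIntegral.integral_of_le (by norm_num), ENNReal.toReal_ofReal (by positivity),
    Complex.real_smul]
  push_cast
  ring

lemma integral_sphere_inv {a : ℂ} (ha : 0 < a.re) {k : ℝ} (hk : k ≠ 0) :
    ∫ Ω : Metric.sphere (0 : R3) 1, (a + Complex.I * k * ((Ω : R3) 0 : ℝ))⁻¹
      ∂(volume : Measure R3).toSphere = 4 * π * (Complex.arctan (k / a) / k) := by
  have hne (μ : ℝ) : a + Complex.I * k * μ ≠ 0 := fun h => by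
    have := congrArg Complex.re h
    simp at this
    exact ha.ne' this
  rw [integral_sphere_comp_eval_zero (g := fun μ : ℝ => (a + Complex.I * k * μ)⁻¹)
    (Continuous.inv₀ (by fun_prop) hne), integral_inv_add_mul_I ha hk]
  ring

lemma toSphere_real_univ : (volume : Measure R3).toSphere.real univ = 4 * π := by
  have h := integral_sphere_pow 0
  simp only [pow_zero, integral_const, smul_eq_mul, mul_one] at h
  rw [h]
  norm_num
  ring

/-- The angular integral of the collision term on an energy shell where the Boltzmann equation
holds, in terms of `H`. -/
lemma integral_sphere_collision {sA sS k : ℝ} (hk : k ≠ 0) {ω D A H : ℂ}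
    (ha : 0 < (((sA + sS : ℝ) : ℂ) - Complex.I * ω).re)
    (hH : H = Complex.arctan (k / (((sA + sS : ℝ) : ℂ) - Complex.I * ω)) / k)
    (hne : 1 - sS * H ≠ 0) {f : Metric.sphere (0 : R3) 1 → ℂ}
    (hA : A = (4 * π : ℝ)⁻¹ • ∫ Ω, f Ω ∂(volume : Measure R3).toSphere)
    (hf : ∀ᵐ Ω : Metric.sphere (0 : R3) 1 ∂(volume : Measure R3).toSphere,
      -Complex.I * (ω - k * ((Ω : R3) 0 : ℝ)) * f Ω = sA * (D - f Ω) + sS * (A - f Ω)) :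
    ∫ Ω, (sA * (D - f Ω) + sS * (A - f Ω)) ∂(volume : Measure R3).toSphere
      = 4 * π * D * (sA * (1 - ((sA + sS : ℝ) : ℂ) * H) / (1 - sS * H)) := by
  set a : ℂ := ((sA + sS : ℝ) : ℂ) - Complex.I * ω with ha'
  have hane (μ : ℝ) : a + Complex.I * k * μ ≠ 0 := fun h => by
    have := congrArg Complex.re h
    simp only [Complex.add_re, Complex.mul_re, Complex.I_re, Complex.I_im, Complex.ofReal_re,
      Complex.ofReal_im, Complex.mul_im, Complex.zero_re] at this
    linarith
  have hsol : f =ᵐ[(volume : Measure R3).toSphere] fun Ω : Metric.sphere (0 : R3) 1 =>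
      (sA * D + sS * A) * (a + Complex.I * k * ((Ω : R3) 0 : ℝ))⁻¹ := by
    filter_upwards [hf] with Ω hΩ
    rw [eq_mul_inv_iff_mul_eq₀ (hane _), ha']
    push_cast
    linear_combination hΩ
  have hcont : Continuous fun Ω : Metric.sphere (0 : R3) 1 =>
      (a + Complex.I * k * ((Ω : R3) 0 : ℝ))⁻¹ :=
    Continuous.inv₀ (by fun_prop) fun _ => hane _
  have hint : Integrable f (volume : Measure R3).toSphere :=
    ((hcont.integrable_of_hasCompactSupport (HasCompactSupport.of_compactSpace _)).const_mul
      _).congr hsol.symm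
  have hπ : (π : ℂ) ≠ 0 := by exact_mod_cast pi_ne_zero
  have hIf : ∫ Ω, f Ω ∂(volume : Measure R3).toSphere = 4 * π * A := by
    rw [hA, Complex.real_smul]
    push_cast
    field_simp
  have hAeq : A = (sA * D + sS * A) * H := by
    have h1 := integral_congr_ae hsol
    rw [hIf, integral_const_mul, integral_sphere_inv ha hk, ← hH] at h1
    have : (4 * π : ℂ) ≠ 0 := by simp [hπ]
    refine mul_left_cancel₀ this ?_
    linear_combination h1
  have hsplit (Ω : Metric.sphere (0 : R3) 1) :
      sA * (D - f Ω) + sS * (A - f Ω) = (sA * D + sS * A) - (sA + sS) * f Ω := by ring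
  simp only [hsplit]
  rw [integral_sub (integrable_const _) (hint.const_mul _), integral_const, toSphere_real_univ,
    integral_const_mul, hIf, Complex.real_smul, ← mul_div_assoc, eq_div_iff hne]
  push_cast
  linear_combination -(4 * π * sA : ℂ) * hAeq

theorem general_dispersion_relation
    (T cM : ℝ) (hT : 0 < T) (hcM : 0 < cM)
    (σA σS : ℝ → ℝ) (hσAm : Measurable σA) (hσSm : Measurable σS)
    (hσA : ∀ q ∈ Ioi (0 : ℝ), 0 ≤ σA q) (hσS : ∀ q ∈ Ioi (0 : ℝ), 0 ≤ σS q)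
    (k : ℝ) (hk : k ≠ 0) (ω : ℂ) (δT : ℂ) (hδT : δT ≠ 0)
    (δf : R3 → ℂ) (hδf : Measurable δf)
    -- a.e. conditions ensuring `H` and the denominators are well defined
    (hpos : ∀ᵐ q ∂(volume.restrict (Ioi (0 : ℝ))),
      0 < ((((σA q + σS q : ℝ) : ℂ) - Complex.I * ω)).re ∧
      1 - (σS q : ℂ) * Hfun σA σS ω k q ≠ 0)
    -- equation (i): energy conservation
    (heq1 : -Complex.I * cM * ω * δT =
      -∫ p : R3, ((2 / (2 * Real.pi) ^ 3 * ‖p‖ : ℝ) : ℂ) * coll σA σS T δT δf p)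
    -- equation (ii): Boltzmann equation, for a.e. p
    (heq2 : ∀ᵐ p : R3, -Complex.I * (ω - (k : ℂ) * ((p 0 / ‖p‖ : ℝ) : ℂ)) * δf p =
      coll σA σS T δT δf p)
    -- finiteness assumptions
    (hInt1 : Integrable (fun p : R3 => wgt T ‖p‖ * ‖δf p‖ ^ 2))
    (hInt2 : Integrable (fun p : R3 => wgt T ‖p‖ * σA ‖p‖ * ‖δfBB T δT ‖p‖ - δf p‖ ^ 2))
    (hInt3 : Integrable (fun p : R3 => wgt T ‖p‖ * σS ‖p‖ * ‖sphAvg δf ‖p‖ - δf p‖ ^ 2))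
    (hInt4 : Integrable (fun p : R3 =>
      ((2 / (2 * Real.pi) ^ 3 * ‖p‖ : ℝ) : ℂ) * coll σA σS T δT δf p))
    -- integrability of the Rosseland-weighted integrand
    (hInt5 : Integrable (fun q : ℝ => ((q ^ 4 * fBB T q * (1 + fBB T q) : ℝ) : ℂ) *
        ((σA q : ℂ) * (1 - (((σA q + σS q : ℝ)) : ℂ) * Hfun σA σS ω k q) /
          (1 - (σS q : ℂ) * Hfun σA σS ω k q)))
      (volume.restrict (Ioi (0 : ℝ)))) :
    ω = -Complex.I * ((4 * Real.pi ^ 2 * T ^ 3 / 15 / cM : ℝ) : ℂ) *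
        ((∫ q in Ioi (0 : ℝ), ((q ^ 4 * fBB T q * (1 + fBB T q) : ℝ) : ℂ) *
            ((σA q : ℂ) * (1 - (((σA q + σS q : ℝ)) : ℂ) * Hfun σA σS ω k q) /
              (1 - (σS q : ℂ) * Hfun σA σS ω k q))) /
          ((∫ q in Ioi (0 : ℝ), q ^ 4 * fBB T q * (1 + fBB T q) : ℝ) : ℂ)) := by
  have hπ : (π : ℂ) ≠ 0 := by exact_mod_cast pi_ne_zero
  have hTC : (T : ℂ) ≠ 0 := by exact_mod_cast hT.ne'
  have hcC : (cM : ℂ) ≠ 0 := by exact_mod_cast hcM.ne'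
  have hshell : ∀ᵐ r ∂volume.restrict (Ioi (0 : ℝ)),
      r ^ 2 • ∫ Ω : Metric.sphere (0 : R3) 1,
        ((2 / (2 * π) ^ 3 * ‖r • (Ω : R3)‖ : ℝ) : ℂ) * coll σA σS T δT δf (r • (Ω : R3))
          ∂(volume : Measure R3).toSphere
      = δT / (π ^ 2 * T ^ 2) * (((r ^ 4 * fBB T r * (1 + fBB T r) : ℝ) : ℂ) *
        ((σA r : ℂ) * (1 - (((σA r + σS r : ℝ)) : ℂ) * Hfun σA σS ω k r) /
          (1 - (σS r : ℂ) * Hfun σA σS ω k r))) := by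
    filter_upwards [hpos, ae_ae_polar heq2, ae_restrict_mem measurableSet_Ioi]
      with r ⟨hre, hne⟩ hB (hr : 0 < r)
    have hnorm (Ω : Metric.sphere (0 : R3) 1) : ‖r • (Ω : R3)‖ = r := by
      simp [norm_smul, abs_of_pos hr]
    have hdir (Ω : Metric.sphere (0 : R3) 1) : (r • (Ω : R3)) 0 / r = (Ω : R3) 0 := by
      rw [PiLp.smul_apply, smul_eq_mul, mul_div_cancel_left₀ _ hr.ne']
    simp only [coll, hnorm, hdir] at hB ⊢
    rw [integral_const_mul, integral_sphere_collision (A := sphAvg δf r)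
      (H := Hfun σA σS ω k r) hk hre rfl hne rfl hB, Complex.real_smul, δfBB]
    push_cast
    generalize ((σA r : ℂ) * (1 - ((σA r : ℂ) + σS r) * Hfun σA σS ω k r) /
      (1 - (σS r : ℂ) * Hfun σA σS ω k r)) = X
    field_simp
    ring
  have henergy := heq1
  rw [integral_polar hInt4, integral_congr_ae hshell, integral_const_mul] at henergy
  rw [integral_pow_four_mul_fBB hT]
  generalize (∫ q in Ioi (0 : ℝ), ((q ^ 4 * fBB T q * (1 + fBB T q) : ℝ) : ℂ) *
      ((σA q : ℂ) * (1 - (((σA q + σS q : ℝ)) : ℂ) * Hfun σA σS ω k q) /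
        (1 - (σS q : ℂ) * Hfun σA σS ω k q))) = X at henergy ⊢
  have hω : ω = -Complex.I * X / (cM * π ^ 2 * T ^ 2) := by
    rw [eq_div_iff (by simp [hπ, hTC, hcC])]
    refine mul_left_cancel₀ hδT ?_
    field_simp at henergy
    linear_combination (δT * Complex.I) * henergy +
      (cM * π ^ 2 * T ^ 2 * ω * δT) * Complex.I_sq
  rw [hω]
  push_cast
  field_simp
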